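/- Every robot grid search problem is synchronizing: for every robot grid search problem (X, U, f) there exist a finite action sequence ũ and a state x_F ∈ X such that x_I⌢ũ = x_F for every initial state x_I ∈ X. -/

import Mathlib

/-- The four unit-length grid actions `left, right, up, down`. -/
def Ugrid : Set (ℤ × ℤ) := {(-1, 0), (1, 0), (0, 1), (0, -1)}

/-- A subset `Z ⊆ ℤ×ℤ` is a connected grid if any two of its points are joined by
a finite chain of points of `Z` in which consecutive points are at (Euclidean)
distance `1`, i.e. the coordinate differences have absolute values summing to `1`. -/
def ConnectedGrid (Z : Set (ℤ × ℤ)) : Prop :=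
  ∀ z1 ∈ Z, ∀ z2 ∈ Z, ∃ n : ℕ, ∃ x : Fin (n + 1) → ℤ × ℤ,
    (∀ k, x k ∈ Z) ∧ x 0 = z1 ∧ x (Fin.last n) = z2 ∧
    ∀ k : Fin n, ((x k.succ).1 - (x k.castSucc).1).natAbs
      + ((x k.succ).2 - (x k.castSucc).2).natAbs = 1

/-- The stay-put transition function: `f(x,u) = x + u` if `x + u ∈ X`, else `x`. -/
noncomputable def fstep (X : Set (ℤ × ℤ)) (x u : ℤ × ℤ) : ℤ × ℤ :=
  @ite _ (x + u ∈ X) (Classical.propDecidable _) (x + u) x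

/-- The word `w` of grid actions leads from `p` to `q` without ever being blocked. -/
def IsFreeWord (X : Set (ℤ × ℤ)) : ℤ × ℤ → List (ℤ × ℤ) → ℤ × ℤ → Prop
  | p, [], q => p = q
  | p, u :: w, q => u ∈ Ugrid ∧ p + u ∈ X ∧ IsFreeWord X (p + u) w q

/-- Some word of grid actions brings both `p` and `q` to the same state. -/
def Mergeable (X : Set (ℤ × ℤ)) (p q : ℤ × ℤ) : Prop :=
  ∃ us : List (ℤ × ℤ), (∀ u ∈ us, u ∈ Ugrid) ∧
    us.foldl (fstep X) p = us.foldl (fstep X) q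

theorem fstep_of_mem {X : Set (ℤ × ℤ)} {x u : ℤ × ℤ} (h : x + u ∈ X) :
    fstep X x u = x + u := if_pos h

theorem fstep_of_notMem {X : Set (ℤ × ℤ)} {x u : ℤ × ℤ} (h : x + u ∉ X) :
    fstep X x u = x := if_neg h

theorem fstep_mem {X : Set (ℤ × ℤ)} {x : ℤ × ℤ} (hx : x ∈ X) (u : ℤ × ℤ) :
    fstep X x u ∈ X := by
  by_cases h : x + u ∈ X
  · rwa [fstep_of_mem h]
  · rwa [fstep_of_notMem h]

theorem foldl_fstep_mem {X : Set (ℤ × ℤ)} {x : ℤ × ℤ} (hx : x ∈ X) (us : List (ℤ × ℤ)) :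
    us.foldl (fstep X) x ∈ X := by
  induction us generalizing x with
  | nil => exact hx
  | cons u us ih => exact ih (fstep_mem hx u)

theorem Mergeable.of_fstep {X : Set (ℤ × ℤ)} {p q u : ℤ × ℤ} (hu : u ∈ Ugrid)
    (h : Mergeable X (fstep X p u) (fstep X q u)) : Mergeable X p q := by
  obtain ⟨us, hus, heq⟩ := h
  exact ⟨u :: us, by simpa [hu] using hus, heq⟩

theorem IsFreeWord.eq_add_sum {X : Set (ℤ × ℤ)} {p q : ℤ × ℤ} {w : List (ℤ × ℤ)}
    (h : IsFreeWord X p w q) : q = p + w.sum := by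
  induction w generalizing p with
  | nil => simpa using h.symm
  | cons u w ih => rw [ih h.2.2, List.sum_cons, add_assoc]

theorem IsFreeWord.concat {X : Set (ℤ × ℤ)} {p q u : ℤ × ℤ} {w : List (ℤ × ℤ)}
    (h : IsFreeWord X p w q) (hu : u ∈ Ugrid) (hq : q + u ∈ X) :
    IsFreeWord X p (w ++ [u]) (q + u) := by
  induction w generalizing p with
  | nil => obtain rfl : p = q := h; exact ⟨hu, hq, rfl⟩
  | cons v w ih => exact ⟨h.1, h.2.1, ih h.2.2⟩

/-- If shorter free words guarantee mergeability but `p` and `q` do not merge, then the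
first part `r` of a free word from `p` to `q` is also free from `q`. -/
theorem IsFreeWord.of_not_mergeable {X : Set (ℤ × ℤ)} {n : ℕ}
    (hn : ∀ p q w, q ∈ X → IsFreeWord X p w q → w.length < n → Mergeable X p q)
    (r : List (ℤ × ℤ)) : ∀ (s : List (ℤ × ℤ)) (p q : ℤ × ℤ), q ∈ X →
      IsFreeWord X p (r ++ s) q → (r ++ s).length = n → ¬ Mergeable X p q →
      IsFreeWord X q r (q + r.sum) ∧ q + r.sum ∈ X ∧
        ¬ Mergeable X (p + r.sum) (q + r.sum) := by
  induction r with
  | nil =>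
    intro s p q hq _ _ hm
    simpa [IsFreeWord] using And.intro hq hm
  | cons u r ih =>
    intro s p q hq hw hlen hm
    obtain ⟨hu, hpu, hw⟩ := hw
    have hqu : q + u ∈ X := by
      by_contra hqu
      refine hm (.of_fstep hu ?_)
      rw [fstep_of_mem hpu, fstep_of_notMem hqu]
      exact hn _ _ (r ++ s) hq hw (by simp at hlen ⊢; omega)
    have hm' : ¬ Mergeable X (p + u) (q + u) := fun h =>
      hm (.of_fstep hu (by rwa [fstep_of_mem hpu, fstep_of_mem hqu]))
    have h := ih (s ++ [u]) (p + u) (q + u) hqu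
      (by simpa using IsFreeWord.concat hw hu hqu) (by simp at hlen ⊢; omega) hm'
    simp only [List.sum_cons, ← add_assoc]
    exact ⟨⟨hu, hqu, h.1⟩, h.2⟩

theorem IsFreeWord.mergeable {X : Set (ℤ × ℤ)} (hfin : X.Finite) (n : ℕ) :
    ∀ p q w, q ∈ X → IsFreeWord X p w q → w.length = n → Mergeable X p q := by
  induction n using Nat.strong_induction_on with
  | _ n ih =>
    intro p q w hq hw hlen
    by_contra hm
    have hn : ∀ p q w, q ∈ X → IsFreeWord X p w q → w.length < n → Mergeable X p q :=
      fun p q w hq hw h => ih _ h p q w hq hw rfl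
    have hqp := hw.eq_add_sum
    have hd : w.sum ≠ 0 := fun h0 => hm ⟨[], by simp, by simp [hqp, h0]⟩
    have key : ∀ k : ℕ, q + k • w.sum ∈ X ∧
        IsFreeWord X (p + k • w.sum) w (q + k • w.sum) ∧
        ¬ Mergeable X (p + k • w.sum) (q + k • w.sum) := by
      intro k
      induction k with
      | zero => simpa using ⟨hq, hw, hm⟩
      | succ k ihk =>
        obtain ⟨h1, h2, h3⟩ := ihk
        obtain ⟨a, b, c⟩ := IsFreeWord.of_not_mergeable hn w [] _ _ h1 (by simpa using h2)
          (by simpa using hlen) h3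
        have e : p + (k + 1) • w.sum = q + k • w.sum := by
          rw [hqp, succ_nsmul']; abel
        rw [e, succ_nsmul, ← add_assoc]
        refine ⟨b, a, ?_⟩
        rwa [add_assoc p, ← succ_nsmul, e] at c
    refine Set.infinite_of_injective_forall_mem (f := fun k : ℕ => q + k • w.sum) ?_
      (fun k => (key k).1) hfin
    intro a b hab
    have h : a • w.sum = b • w.sum := add_left_cancel hab
    rw [← natCast_zsmul, ← natCast_zsmul] at h
    exact Nat.cast_injective (smul_left_injective ℤ hd h)

theorem sub_mem_Ugrid {a b : ℤ × ℤ} (h : (b.1 - a.1).natAbs + (b.2 - a.2).natAbs = 1) :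
    b - a ∈ Ugrid := by
  simp only [Ugrid, Set.mem_insert_iff, Set.mem_singleton_iff, Prod.ext_iff, Prod.fst_sub,
    Prod.snd_sub]
  omega

theorem ConnectedGrid.exists_isFreeWord {X : Set (ℤ × ℤ)} (hconn : ConnectedGrid X)
    {p q : ℤ × ℤ} (hp : p ∈ X) (hq : q ∈ X) : ∃ w, IsFreeWord X p w q := by
  obtain ⟨n, x, hx, rfl, rfl, hstep⟩ := hconn p hp q hq
  suffices h : ∀ k : Fin (n + 1), ∃ w, IsFreeWord X (x 0) w (x k) from h _
  intro k
  induction k using Fin.induction with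
  | zero => exact ⟨[], rfl⟩
  | succ k ih =>
    obtain ⟨w, hw⟩ := ih
    have e : x k.castSucc + (x k.succ - x k.castSucc) = x k.succ := by abel
    have h := hw.concat (sub_mem_Ugrid (hstep k)) (by rw [e]; exact hx _)
    rw [e] at h
    exact ⟨_, h⟩

theorem ConnectedGrid.mergeable {X : Set (ℤ × ℤ)} (hfin : X.Finite) (hconn : ConnectedGrid X)
    {p q : ℤ × ℤ} (hp : p ∈ X) (hq : q ∈ X) : Mergeable X p q := by
  obtain ⟨w, hw⟩ := hconn.exists_isFreeWord hp hq
  exact IsFreeWord.mergeable hfin _ p q w hq hw rfl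

/-- **Every robot grid search problem is synchronizing**: some finite action
sequence brings every initial state to one common final state `x_F ∈ X`. -/
theorem stmt5 (X : Set (ℤ × ℤ)) (hfin : X.Finite) (hne : X.Nonempty)
    (hconn : ConnectedGrid X) :
    ∃ us : List (ℤ × ℤ), (∀ u ∈ us, u ∈ Ugrid) ∧
      ∃ xF ∈ X, ∀ xI ∈ X, us.foldl (fstep X) xI = xF := by
  suffices h : ∀ S : Set (ℤ × ℤ), S.Finite → S ⊆ X →
      ∃ us : List (ℤ × ℤ), (∀ u ∈ us, u ∈ Ugrid) ∧
        ∃ xF ∈ X, ∀ xI ∈ S, us.foldl (fstep X) xI = xF from h X hfin subset_rfl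
  intro S hS
  induction S, hS using Set.Finite.induction_on with
  | empty =>
    intro _
    obtain ⟨x, hx⟩ := hne
    exact ⟨[], by simp, x, hx, by simp⟩
  | @insert a S _ _ ih =>
    intro hsub
    obtain ⟨us, hus, xF, hxF, h⟩ := ih ((Set.subset_insert a S).trans hsub)
    have ha : a ∈ X := hsub (Set.mem_insert a S)
    obtain ⟨vs, hvs, hv⟩ := hconn.mergeable hfin (foldl_fstep_mem ha us) hxF
    refine ⟨us ++ vs, ?_, vs.foldl (fstep X) xF, foldl_fstep_mem hxF vs, ?_⟩
    · intro u hu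
      exact (List.mem_append.1 hu).elim (hus u) (hvs u)
    · rintro x (rfl | hx)
      · rw [List.foldl_append, hv]
      · rw [List.foldl_append, h x hx]
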